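/- arXiv:2405.11142 — 8 statements merged into one kernel-verified Lean document; each statement's English description precedes it below -/
import Mathlib

section
/- In the two-type screening setting, the full-revelation menu (all four signal precisions equal to 1, t_l = (1-μ)u(l), t_h = (1-μ)u(h)) satisfies all incentive compatibility and individual rationality constraints if and only if μ·u(h) + (1-μ)·u(l) ≥ (max{μ(1-p), μp} + max{μp, 1-μ-μp})·u(h). -/
/-! Two-type screening setting: parameters `μ ∈ [1/2,1)`, `p ∈ [0,(1-μ)/μ]`,
ex-post payoffs `u(h) > u(l) > 0`, low-type probability `ρ ∈ (0,1)`.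
`σg = μ(1-p)`, `ξ = μp`, `σb = 1-μ-μp`. -/

noncomputable section

namespace TwoTypeScreening

/-- A menu `(π_{g,l}, π_{b,l}, π_{g,h}, π_{b,h}, t_l, t_h)`. -/
structure Menu where
  pgl : ℝ
  pbl : ℝ
  pgh : ℝ
  pbh : ℝ
  tl : ℝ
  th : ℝ

/-- Each signal precision lies in `[0,1]`. -/
def Menu.Valid (m : Menu) : Prop :=
  m.pgl ∈ Set.Icc (0:ℝ) 1 ∧ m.pbl ∈ Set.Icc (0:ℝ) 1 ∧
  m.pgh ∈ Set.Icc (0:ℝ) 1 ∧ m.pbh ∈ Set.Icc (0:ℝ) 1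

def σg (μ p : ℝ) : ℝ := μ * (1 - p)
def ξ (μ p : ℝ) : ℝ := μ * p
def σb (μ p : ℝ) : ℝ := 1 - μ - μ * p

/-- Own value of type `l`'s product for type `l`. -/
def Vl (μ ul : ℝ) (m : Menu) : ℝ := (μ * m.pgl + (1 - μ) * m.pbl - μ) * ul

/-- Own value of type `h`'s product for type `h`. -/
def Vh (μ uh : ℝ) (m : Menu) : ℝ := (μ * m.pgh + (1 - μ) * m.pbh - μ) * uh

/-- Cross-value kernel: the expected probability of a correct action for the other
type from a product with precisions `(pg, pb)`, minus the prior `μ`. -/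
def cross (μ p pg pb : ℝ) : ℝ :=
  max (σg μ p * pg + ξ μ p * (1 - pb)) (ξ μ p * pg + σb μ p * (1 - pb)) +
  max (σg μ p * (1 - pg) + ξ μ p * pb) (ξ μ p * (1 - pg) + σb μ p * pb) - μ

/-- Value of type `h`'s product for type `l`. -/
def Wl (μ p ul : ℝ) (m : Menu) : ℝ := cross μ p m.pgh m.pbh * ul

/-- Value of type `l`'s product for type `h`. -/
def Wh (μ p uh : ℝ) (m : Menu) : ℝ := cross μ p m.pgl m.pbl * uh

/-- Incentive compatibility. -/
def IC (μ p ul uh : ℝ) (m : Menu) : Prop :=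
  Vl μ ul m - m.tl ≥ Wl μ p ul m - m.th ∧
  Vh μ uh m - m.th ≥ Wh μ p uh m - m.tl

/-- Individual rationality. -/
def IR (μ ul uh : ℝ) (m : Menu) : Prop :=
  Vl μ ul m - m.tl ≥ 0 ∧ Vh μ uh m - m.th ≥ 0

/-- Responsiveness. -/
def Rsp (μ : ℝ) (m : Menu) : Prop :=
  μ * m.pgl + (1 - μ) * m.pbl ≥ μ ∧ μ * m.pgh + (1 - μ) * m.pbh ≥ μ

/-- Seller's revenue. -/
def revenue (ρ : ℝ) (m : Menu) : ℝ := ρ * m.tl + (1 - ρ) * m.th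

/-- The full-revelation menu priced at full willingness to pay. -/
def fullMenu (μ ul uh : ℝ) : Menu :=
  ⟨1, 1, 1, 1, (1 - μ) * ul, (1 - μ) * uh⟩

end TwoTypeScreening

open TwoTypeScreening in
/-- The full-revelation menu satisfies IC and IR iff
`μ·u(h) + (1-μ)·u(l) ≥ (max{μ(1-p), μp} + max{μp, 1-μ-μp})·u(h)`. -/
theorem fullMenu_IC_IR_iff
    (μ p ul uh ρ : ℝ)
    (hμ : μ ∈ Set.Ico (1/2 : ℝ) 1)
    (hp : p ∈ Set.Icc (0:ℝ) ((1 - μ) / μ))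
    (hul : 0 < ul) (hu : ul < uh)
    (hρ : ρ ∈ Set.Ioo (0:ℝ) 1) :
    (IC μ p ul uh (fullMenu μ ul uh) ∧ IR μ ul uh (fullMenu μ ul uh)) ↔
      μ * uh + (1 - μ) * ul ≥
        (max (μ * (1 - p)) (μ * p) + max (μ * p) (1 - μ - μ * p)) * uh := by
  obtain ⟨hμ₁, hμ₂⟩ := hμ
  obtain ⟨hp₀, hp₁⟩ := hp
  have hμ₀ : 0 < μ := by linarith
  have hμp : μ * p ≤ 1 - μ := by
    rw [le_div_iff₀ hμ₀] at hp₁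
    linarith
  have hnonneg : 0 ≤ μ * p := mul_nonneg hμ₀.le hp₀
  have hA : max (μ * (1 - p)) (μ * p) ≤ μ := max_le (by linarith) (by linarith)
  have hB : max (μ * p) (1 - μ - μ * p) ≤ 1 - μ := max_le hμp (by linarith)
  simp only [IC, IR, Vl, Vh, Wl, Wh, cross, fullMenu, σg, ξ, σb, sub_self, mul_one, mul_zero,
    add_zero, zero_add]
  set A := max (μ * (1 - p)) (μ * p)
  set B := max (μ * p) (1 - μ - μ * p)
  have hl : (A + B - μ) * ul ≤ (1 - μ) * uh :=
    calc (A + B - μ) * ul ≤ (1 - μ) * ul := by gcongr; linarith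
      _ ≤ (1 - μ) * uh := by gcongr
  constructor
  · rintro ⟨⟨-, hh⟩, -⟩
    linarith
  · intro h
    refine ⟨⟨?_, ?_⟩, ?_, ?_⟩ <;> linarith
end
end

section
/- In the two-type screening setting, suppose condition (C1) holds: either (a) 0 < p < (1-μ)/(2μ) and (1-μ)u(l) ≥ (1-μ-2μp)u(h); or (b) μ ≥ 2/3 and (1-μ)/(2μ) ≤ p ≤ (1-μ)/μ; or (c) μ < 2/3 and either (1-μ)/(2μ) ≤ p ≤ 1/2, or both 1/2 < p ≤ (1-μ)/μ and (1-μ)u(l) ≥ (2p-1)μ·u(h). Then the full-revelation menu satisfies IC and IR, and for every menu satisfying IC and IR its revenue satisfies ρ t_l + (1-ρ) t_h ≤ ρ(1-μ)u(l) + (1-ρ)(1-μ)u(h), which is the revenue of the full-revelation menu; hence the full-revelation menu is revenue-maximal among IC and IR menus. -/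
/-! Two-type screening setting: parameters `μ ∈ [1/2,1)`, `p ∈ [0,(1-μ)/μ]`,
ex-post payoffs `u(h) > u(l) > 0`, low-type probability `ρ ∈ (0,1)`.
`σg = μ(1-p)`, `ξ = μp`, `σb = 1-μ-μp`. -/

noncomputable section

namespace TwoTypeScreening

theorem cross_full_mul_le {μ p u c : ℝ}
    (h₁ : 0 ≤ c)
    (h₂ : (1 - μ - 2 * (μ * p)) * u ≤ c)
    (h₃ : (2 * (μ * p) - μ) * u ≤ c)
    (h₄ : (1 - 2 * μ) * u ≤ c) :
    cross μ p 1 1 * u ≤ c := by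
  unfold cross σg ξ σb
  rcases max_choice (μ * (1 - p) * 1 + μ * p * (1 - 1))
      (μ * p * 1 + (1 - μ - μ * p) * (1 - 1)) with h | h <;>
    rcases max_choice (μ * (1 - p) * (1 - 1) + μ * p * 1)
      (μ * p * (1 - 1) + (1 - μ - μ * p) * 1) with h' | h' <;>
    rw [h, h'] <;> linarith

theorem fullMenu_IC {μ p ul uh : ℝ} (hμ : μ ≤ 1) (hul : 0 < ul) (hu : ul ≤ uh)
    (h : cross μ p 1 1 * uh ≤ (1 - μ) * ul) :
    IC μ p ul uh (fullMenu μ ul uh) := by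
  have hl : cross μ p 1 1 * ul ≤ (1 - μ) * uh := by
    have := mul_le_mul_of_nonneg_left hu (sub_nonneg.2 hμ)
    rcases le_total 0 (cross μ p 1 1) with hc | hc
    · linarith [mul_le_mul_of_nonneg_left hu hc]
    · linarith [mul_nonpos_of_nonpos_of_nonneg hc hul.le, mul_nonneg (sub_nonneg.2 hμ) hul.le]
  constructor <;> simp only [Vl, Vh, Wl, Wh, fullMenu] <;> linarith

theorem own_value_le {μ a b u : ℝ} (hμ₀ : 0 ≤ μ) (hμ₁ : μ ≤ 1) (ha : a ≤ 1) (hb : b ≤ 1)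
    (hu : 0 ≤ u) : (μ * a + (1 - μ) * b - μ) * u ≤ (1 - μ) * u := by
  apply mul_le_mul_of_nonneg_right _ hu
  linarith [mul_le_mul_of_nonneg_left ha hμ₀,
    mul_le_mul_of_nonneg_left hb (sub_nonneg.2 hμ₁)]

end TwoTypeScreening

open TwoTypeScreening in
/-- Under condition (C1), the full-revelation menu is IC and IR, and is
revenue-maximal among valid IC and IR menus, its revenue being the full surplus
`ρ(1-μ)u(l) + (1-ρ)(1-μ)u(h)`. -/
theorem fullMenu_optimal_of_C1
    (μ p ul uh ρ : ℝ)
    (hμ : μ ∈ Set.Ico (1/2 : ℝ) 1)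
    (hp : p ∈ Set.Icc (0:ℝ) ((1 - μ) / μ))
    (hul : 0 < ul) (hu : ul < uh)
    (hρ : ρ ∈ Set.Ioo (0:ℝ) 1)
    (hC1 :
      (0 < p ∧ p < (1 - μ) / (2 * μ) ∧ (1 - μ) * ul ≥ (1 - μ - 2 * μ * p) * uh) ∨
      (2/3 ≤ μ ∧ (1 - μ) / (2 * μ) ≤ p ∧ p ≤ (1 - μ) / μ) ∨
      (μ < 2/3 ∧
        (((1 - μ) / (2 * μ) ≤ p ∧ p ≤ 1/2) ∨
         (1/2 < p ∧ p ≤ (1 - μ) / μ ∧ (1 - μ) * ul ≥ (2 * p - 1) * μ * uh)))) :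
    IC μ p ul uh (fullMenu μ ul uh) ∧ IR μ ul uh (fullMenu μ ul uh) ∧
    revenue ρ (fullMenu μ ul uh) = ρ * ((1 - μ) * ul) + (1 - ρ) * ((1 - μ) * uh) ∧
    ∀ m : Menu, m.Valid → IC μ p ul uh m → IR μ ul uh m →
      revenue ρ m ≤ ρ * ((1 - μ) * ul) + (1 - ρ) * ((1 - μ) * uh) := by
  obtain ⟨hμ₀, hμ₁⟩ := hμ
  have hμpos : 0 < μ := by linarith
  have huh : 0 < uh := hul.trans hu
  have hc : 0 ≤ (1 - μ) * ul := mul_nonneg (by linarith) hul.le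
  have le_of_nonpos {x : ℝ} (hx : x ≤ 0) : x * uh ≤ (1 - μ) * ul :=
    (mul_nonpos_of_nonpos_of_nonneg hx huh.le).trans hc
  have hmid : (1 - μ) / (2 * μ) ≤ p → 1 - μ - 2 * (μ * p) ≤ 0 := fun h => by
    rw [div_le_iff₀ (by positivity)] at h
    linarith
  have htop : μ * p ≤ 1 - μ := by
    have := hp.2
    rw [le_div_iff₀ hμpos] at this
    linarith
  refine ⟨fullMenu_IC hμ₁.le hul hu.le
    (cross_full_mul_le hc ?_ ?_ (le_of_nonpos (by linarith))), ?_, rfl, ?_⟩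
  · rcases hC1 with ⟨-, -, h⟩ | ⟨-, h, -⟩ | ⟨-, ⟨h, -⟩ | ⟨h, -, -⟩⟩
    · linarith
    · exact le_of_nonpos (hmid h)
    · exact le_of_nonpos (hmid h)
    · have := mul_lt_mul_of_pos_left h hμpos
      exact le_of_nonpos (by linarith)
  · rcases hC1 with ⟨-, h, -⟩ | ⟨h, -, -⟩ | ⟨-, ⟨-, h⟩ | ⟨-, -, h⟩⟩
    · rw [lt_div_iff₀ (by positivity)] at h
      exact le_of_nonpos (by linarith)
    · exact le_of_nonpos (by linarith)
    · have := mul_le_mul_of_nonneg_left h hμpos.le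
      exact le_of_nonpos (by linarith)
    · linarith
  · constructor <;> simp only [Vl, Vh, fullMenu] <;> linarith
  · rintro m ⟨hgl, hbl, hgh, hbh⟩ - ⟨hl, hh⟩
    have hVl : Vl μ ul m ≤ (1 - μ) * ul := own_value_le hμpos.le hμ₁.le hgl.2 hbl.2 hul.le
    have hVh : Vh μ uh m ≤ (1 - μ) * uh := own_value_le hμpos.le hμ₁.le hgh.2 hbh.2 huh.le
    exact add_le_add (mul_le_mul_of_nonneg_left (by linarith) hρ.1.le)
      (mul_le_mul_of_nonneg_left (by linarith) (sub_nonneg.2 hρ.2.le))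
end
end

section
/- In the two-type screening setting, for every menu satisfying IC, IR, and Rsp there exists a menu satisfying IC, IR, and Rsp in which the high type's product is fully informative (π_{g,h} = π_{b,h} = 1) and whose revenue is weakly greater. -/
/-! Two-type screening setting: parameters `μ ∈ [1/2,1)`, `p ∈ [0,(1-μ)/μ]`,
ex-post payoffs `u(h) > u(l) > 0`, low-type probability `ρ ∈ (0,1)`.
`σg = μ(1-p)`, `ξ = μp`, `σb = 1-μ-μp`. -/

noncomputable section

namespace TwoTypeScreening

/-- Making a product fully informative raises its cross value by no more than its own value. -/
lemma cross_one_one_sub_cross_le {μ p pg pb : ℝ} (hg : 0 ≤ σg μ p) (hξ : 0 ≤ ξ μ p)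
    (hb : 0 ≤ σb μ p) (hpg : pg ≤ 1) (hpb : pb ≤ 1) :
    cross μ p 1 1 - cross μ p pg pb ≤ μ * (1 - pg) + (1 - μ) * (1 - pb) := by
  have hμ : μ = σg μ p + ξ μ p := by unfold σg ξ; ring
  have hμ' : 1 - μ = ξ μ p + σb μ p := by unfold σb ξ; ring
  unfold cross
  rw [hμ']
  generalize σg μ p = a at *
  generalize ξ μ p = x at *
  generalize σb μ p = b at *
  subst hμ
  have h₁ := le_max_left (a * pg + x * (1 - pb)) (x * pg + b * (1 - pb))
  have h₂ := le_max_right (a * pg + x * (1 - pb)) (x * pg + b * (1 - pb))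
  have h₃ := le_max_left (a * (1 - pg) + x * pb) (x * (1 - pg) + b * pb)
  have h₄ := le_max_right (a * (1 - pg) + x * pb) (x * (1 - pg) + b * pb)
  have ag := mul_nonneg hg (sub_nonneg.2 hpg)
  have xg := mul_nonneg hξ (sub_nonneg.2 hpg)
  have xb := mul_nonneg hξ (sub_nonneg.2 hpb)
  have bb := mul_nonneg hb (sub_nonneg.2 hpb)
  rcases max_choice (a * 1 + x * (1 - 1)) (x * 1 + b * (1 - 1)) with e | e <;>
    rcases max_choice (a * (1 - 1) + x * 1) (x * (1 - 1) + b * 1) with e' | e' <;>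
    rw [e, e'] <;> linarith

end TwoTypeScreening

open TwoTypeScreening in
/-- For every valid menu satisfying IC, IR and Rsp there is a valid menu
satisfying IC, IR and Rsp with a fully informative high-type product and weakly
greater revenue (no distortion at the top). -/
theorem no_distortion_at_top
    (μ p ul uh ρ : ℝ)
    (hμ : μ ∈ Set.Ico (1/2 : ℝ) 1)
    (hp : p ∈ Set.Icc (0:ℝ) ((1 - μ) / μ))
    (hul : 0 < ul) (hu : ul < uh)
    (hρ : ρ ∈ Set.Ioo (0:ℝ) 1) :
    ∀ m : Menu, m.Valid → IC μ p ul uh m → IR μ ul uh m → Rsp μ m →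
      ∃ m' : Menu, m'.Valid ∧ IC μ p ul uh m' ∧ IR μ ul uh m' ∧ Rsp μ m' ∧
        m'.pgh = 1 ∧ m'.pbh = 1 ∧ revenue ρ m ≤ revenue ρ m' := by
  obtain ⟨hμ₁, hμ₂⟩ := hμ
  obtain ⟨hp₀, hp₁⟩ := hp
  have hμ₀ : 0 < μ := by linarith
  rw [le_div_iff₀ hμ₀] at hp₁
  rintro ⟨pgl, pbl, pgh, pbh, tl, th⟩ ⟨hgl, hbl, ⟨-, hgh⟩, ⟨-, hbh⟩⟩ ⟨hICl, hICh⟩ ⟨hIRl, hIRh⟩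
    ⟨hRl, -⟩
  have hgain := cross_one_one_sub_cross_le (μ := μ) (p := p) (pg := pgh) (pb := pbh)
    (by unfold σg; linarith) (mul_nonneg hμ₀.le hp₀) (by unfold σb; linarith) hgh hbh
  have hloss : 0 ≤ μ * (1 - pgh) + (1 - μ) * (1 - pbh) :=
    add_nonneg (mul_nonneg hμ₀.le (sub_nonneg.2 hgh))
      (mul_nonneg (sub_nonneg.2 hμ₂.le) (sub_nonneg.2 hbh))
  have hgain_l := mul_le_mul_of_nonneg_right hgain hul.le
  have hloss_u := mul_le_mul_of_nonneg_left hu.le hloss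
  have hrev : 0 ≤ (1 - ρ) * ((μ * (1 - pgh) + (1 - μ) * (1 - pbh)) * uh) :=
    mul_nonneg (sub_nonneg.2 hρ.2.le) (mul_nonneg hloss (hul.trans hu).le)
  refine ⟨⟨pgl, pbl, 1, 1, tl, th + (μ * (1 - pgh) + (1 - μ) * (1 - pbh)) * uh⟩,
    ⟨hgl, hbl, by simp, by simp⟩, ⟨?_, ?_⟩, ⟨hIRl, ?_⟩, ⟨hRl, ?_⟩, rfl, rfl, ?_⟩ <;>
    simp only [Vl, Vh, Wl, Wh, revenue] at * <;> linarith
end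
end

section
/- In the two-type screening setting, assume 0 ≤ p < (1-μ)/(2μ) (equivalently σ_g ≥ σ_b > ξ) and (1-μ)u(l) < (σ_b - ξ)u(h) (condition (C1) fails). Then for every menu satisfying IC, IR, and Rsp in which the high type's product is fully informative, there exists a menu satisfying IC, IR, and Rsp with π_{b,l} = 1, the high type's product fully informative, and weakly greater revenue. -/
/-! Two-type screening setting: parameters `μ ∈ [1/2,1)`, `p ∈ [0,(1-μ)/μ]`,
ex-post payoffs `u(h) > u(l) > 0`, low-type probability `ρ ∈ (0,1)`.
`σg = μ(1-p)`, `ξ = μp`, `σb = 1-μ-μp`. -/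

noncomputable section

namespace TwoTypeScreening

/-- Following both signals is one feasible way to act on another type's product. -/
lemma le_cross (μ p a b : ℝ) :
    (σb μ p - ξ μ p) * b - (σg μ p - ξ μ p) * (1 - a) ≤ cross μ p a b := by
  have h₁ := le_max_left (σg μ p * a + ξ μ p * (1 - b)) (ξ μ p * a + σb μ p * (1 - b))
  have h₂ := le_max_right (σg μ p * (1 - a) + ξ μ p * b) (ξ μ p * (1 - a) + σb μ p * b)
  unfold cross
  simp only [σg, ξ, σb] at *
  linarith

/-- With an undistorted bad signal, the cross value comes from following both signals or from
ignoring the product. -/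
lemma cross_one_right {μ p a : ℝ} (ha : 0 ≤ a) (hσ : ξ μ p ≤ σg μ p) :
    cross μ p a 1 = max 0 (σb μ p - ξ μ p - (σg μ p - ξ μ p) * (1 - a)) := by
  have h : max (σg μ p * a + ξ μ p * (1 - 1)) (ξ μ p * a + σb μ p * (1 - 1)) = σg μ p * a := by
    rw [max_eq_left (by nlinarith)]
    ring
  unfold cross
  rw [h, add_sub_right_comm, ← max_add_add_left]
  congr 1 <;> simp only [σg, ξ, σb] <;> ring

/-- Trading precision of the good signal for precision of the bad signal at a fixed information
rent of the high type does not lower the low type's value. Here `D` and `G` are the marginal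
effects of the two precisions on that rent. -/
lemma exists_undistorted {μ D G a b : ℝ} (hμ : 1 / 2 ≤ μ) (hμ1 : μ < 1) (hD : 0 < D)
    (hDG : μ * D ≤ (1 - μ) * G) (ha : a ∈ Set.Icc (0 : ℝ) 1) (hb : b ∈ Set.Icc (0 : ℝ) 1) :
    ∃ a' ∈ Set.Icc (0 : ℝ) 1, D - G * (1 - a') = max 0 (D * b - G * (1 - a)) ∧
      μ * a + (1 - μ) * b ≤ μ * a' + (1 - μ) * 1 := by
  obtain ⟨ha0, ha1⟩ := ha
  obtain ⟨hb0, hb1⟩ := hb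
  have hG : 0 < G := by
    by_contra! h
    nlinarith
  have hGD : D ≤ G := by
    by_contra! h
    nlinarith
  set s := max 0 (D * b - G * (1 - a)) with hs
  have hs0 : 0 ≤ s := le_max_left _ _
  have hsD : s ≤ D := max_le hD.le (by nlinarith)
  have hx : G * ((D - s) / G) = D - s := by field_simp
  set x := (D - s) / G
  have hx0 : 0 ≤ x := div_nonneg (by linarith) hG.le
  have hx1 : x ≤ 1 := (div_le_one hG).2 (by linarith)
  refine ⟨1 - x, ⟨by linarith, by linarith⟩, by linear_combination -hx, ?_⟩
  have key : 0 ≤ G * ((1 - μ) * (1 - b) - μ * (x - (1 - a))) := by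
    have h₁ := le_max_right 0 (D * b - G * (1 - a))
    have h₂ := mul_nonneg (sub_nonneg.2 hb1) (sub_nonneg.2 hDG)
    have h₃ : 0 ≤ μ * (s - (D * b - G * (1 - a))) := mul_nonneg (by linarith) (by linarith)
    have h₄ : G * (μ * x) = μ * (D - s) := by rw [← hx]; ring
    linarith
  have := nonneg_of_mul_nonneg_right key hG
  linarith

end TwoTypeScreening

open TwoTypeScreening in
/-- When `0 ≤ p < (1-μ)/(2μ)` (so `σ_g ≥ σ_b > ξ`) and condition (C1)
fails (`(1-μ)u(l) < (σ_b - ξ)u(h)`), any valid IC, IR, Rsp menu with a fully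
informative high-type product is weakly revenue-dominated by one that additionally
does not distort the low type's bad-state signal (`π_{b,l} = 1`). -/
theorem no_distortion_bad_signal
    (μ p ul uh ρ : ℝ)
    (hμ : μ ∈ Set.Ico (1/2 : ℝ) 1)
    (hp0 : 0 ≤ p) (hp1 : p < (1 - μ) / (2 * μ))
    (hul : 0 < ul) (hu : ul < uh)
    (hρ : ρ ∈ Set.Ioo (0:ℝ) 1)
    (hnotC1 : (1 - μ) * ul < (σb μ p - ξ μ p) * uh) :
    ∀ m : Menu, m.Valid → IC μ p ul uh m → IR μ ul uh m → Rsp μ m →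
      m.pgh = 1 → m.pbh = 1 →
      ∃ m' : Menu, m'.Valid ∧ IC μ p ul uh m' ∧ IR μ ul uh m' ∧ Rsp μ m' ∧
        m'.pbl = 1 ∧ m'.pgh = 1 ∧ m'.pbh = 1 ∧ revenue ρ m ≤ revenue ρ m' := by
  rintro m ⟨hgl, hbl, -, -⟩ ⟨-, hICh⟩ ⟨hIRl, hIRh⟩ ⟨hRl, -⟩ hgh hbh
  obtain ⟨hμ2, hμ1⟩ := hμ
  obtain ⟨hρ0, hρ1⟩ := hρ
  have hμp : 2 * (μ * p) < 1 - μ := by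
    rw [lt_div_iff₀ (by linarith)] at hp1
    linarith
  have hμp0 : 0 ≤ μ * p := mul_nonneg (by linarith) hp0
  have hσ : ξ μ p ≤ σg μ p := by simp only [ξ, σg]; linarith
  have hslope : μ * ((σb μ p - ξ μ p) * uh - (1 - μ) * ul) ≤
      (1 - μ) * ((σg μ p - ξ μ p) * uh - μ * ul) := by
    have := mul_nonneg (mul_nonneg hμp0 (hul.trans hu).le) (by linarith : 0 ≤ 2 * μ - 1)
    simp only [ξ, σg, σb]
    linarith
  obtain ⟨a, ⟨ha0, ha1⟩, hrent, hval⟩ :=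
    exists_undistorted hμ2 hμ1 (sub_pos.2 hnotC1) hslope hgl hbl
  set s := max 0 (((σb μ p - ξ μ p) * uh - (1 - μ) * ul) * m.pbl -
    ((σg μ p - ξ μ p) * uh - μ * ul) * (1 - m.pgl))
  have hs0 : 0 ≤ s := le_max_left _ _
  have hcross := mul_le_mul_of_nonneg_right (le_cross μ p m.pgl m.pbl) (hul.trans hu).le
  simp only [Vl, Vh, Wh, hgh, hbh] at hICh hIRl hIRh
  have hth : m.th ≤ (1 - μ) * uh - s := by
    have : s ≤ (1 - μ) * uh - m.th := max_le (by linarith) (by linarith)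
    linarith
  have htl : m.tl ≤ (μ * a + (1 - μ) * 1 - μ) * ul := by
    have := mul_le_mul_of_nonneg_right hval hul.le
    linarith
  have hv : 0 ≤ (μ * a + (1 - μ) * 1 - μ) * ul := mul_nonneg (by linarith) hul.le
  refine ⟨⟨a, 1, 1, 1, (μ * a + (1 - μ) * 1 - μ) * ul, (1 - μ) * uh - s⟩,
    ⟨⟨ha0, ha1⟩, by simp, by simp, by simp⟩, ⟨?_, ?_⟩, ⟨?_, ?_⟩, ⟨?_, ?_⟩, rfl, rfl, rfl, ?_⟩
  · have hD : max 0 (σb μ p - ξ μ p - (σg μ p - ξ μ p) * (1 - 1)) = σb μ p - ξ μ p := by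
      rw [sub_self, mul_zero, sub_zero]
      exact max_eq_right (by simp only [ξ, σb]; linarith)
    simp only [Vl, Wl]
    rw [cross_one_right zero_le_one hσ, hD]
    have hG : 0 ≤ ((σg μ p - ξ μ p) * uh - μ * ul) * (1 - a) := by
      refine mul_nonneg ?_ (by linarith)
      refine nonneg_of_mul_nonneg_right (le_trans ?_ hslope) (by linarith)
      exact mul_nonneg (by linarith) (by linarith)
    have h₁ := mul_nonneg hμp0 (by linarith : 0 ≤ uh + ul)
    simp only [ξ, σg, σb] at *
    linarith
  · simp only [Vh, Wh]
    rw [cross_one_right ha0 hσ, max_mul_of_nonneg _ _ (hul.trans hu).le]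
    have : max (0 * uh) ((σb μ p - ξ μ p - (σg μ p - ξ μ p) * (1 - a)) * uh) ≤
        s + (μ * a + (1 - μ) * 1 - μ) * ul := max_le (by linarith) (by linarith)
    linarith
  · simp [Vl]
  · simp only [Vh]
    linarith
  · change μ * a + (1 - μ) * 1 ≥ μ
    linarith
  · change μ * 1 + (1 - μ) * 1 ≥ μ
    linarith
  · have h₁ := mul_le_mul_of_nonneg_left htl hρ0.le
    have h₂ := mul_le_mul_of_nonneg_left hth (sub_nonneg.2 hρ1.le)
    simp only [revenue]
    linarith
end
end

section
/- In the two-type screening setting, assume 1/2 < p ≤ (1-μ)/μ (so ξ > σ_g ≥ σ_b, which requires μ < 2/3) and (1-μ)u(l) < (ξ - σ_g)u(h) (condition (C1) fails). (1) If (ξ+σ_b)u(l) ≥ (1-ρ)(ξ-σ_b)u(h), then the menu with π_{g,l}=π_{b,l}=π_{g,h}=π_{b,h}=1, t_l = (σ_b+ξ)u(l), and t_h = (σ_g+σ_b)u(h) + (σ_b+ξ)u(l) satisfies IC, IR, and Rsp; it has weakly greater revenue than every menu satisfying IC, IR, and Rsp; and t_h < (1-μ)u(h). (2) Otherwise, the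 menu with π_{g,h}=π_{b,h}=1, π_{g,l}=1, π_{b,l} = (σ_g-σ_b)u(h) / ((ξ-σ_b)u(h) - (σ_b+ξ)u(l)), t_l = (σ_b+ξ)·π_{b,l}·u(l), and t_h = (σ_b+ξ)u(h) = (1-μ)u(h) satisfies IC, IR, and Rsp, and has weakly greater revenue than every menu satisfying IC, IR, and Rsp. -/
/-! Two-type screening setting: parameters `μ ∈ [1/2,1)`, `p ∈ [0,(1-μ)/μ]`,
ex-post payoffs `u(h) > u(l) > 0`, low-type probability `ρ ∈ (0,1)`.
`σg = μ(1-p)`, `ξ = μp`, `σb = 1-μ-μp`. -/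

noncomputable section

namespace TwoTypeScreening

/-- The cross kernel dominates the value of following, as an action plan, the second branch
of the first maximum and the first branch of the second. -/
lemma cross_ge (μ p a q : ℝ) :
    ξ μ p * a + σb μ p * (1 - q) + (σg μ p * (1 - a) + ξ μ p * q) - μ ≤ cross μ p a q := by
  unfold cross
  gcongr
  · exact le_max_right _ _
  · exact le_max_left _ _

/-- When `ξ ≥ σb`, a product with `πg = 1` and a sufficiently informative bad-state signal has
cross kernel linear in the bad-state precision. -/
lemma cross_one (μ p q : ℝ) (hq : 0 ≤ q) (hb : σb μ p ≤ ξ μ p)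
    (h : σg μ p - σb μ p ≤ (ξ μ p - σb μ p) * q) :
    cross μ p 1 q = ξ μ p + σb μ p * (1 - q) + ξ μ p * q - μ := by
  unfold cross
  rw [max_eq_right (by linarith), max_eq_left (by nlinarith)]
  ring

/-- Lagrangian bound: weight `lam` on the high type's incentive constraint and the remaining
weights on the two participation constraints. -/
lemma revenue_le (μ p ul uh ρ lam : ℝ) (hμ : 0 ≤ μ) (hμ1 : μ ≤ 1) (huh : 0 ≤ uh)
    (hρ0 : 0 ≤ ρ) (hρ1 : ρ ≤ 1) (hlam0 : 0 ≤ lam) (hlam1 : lam ≤ 1 - ρ)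
    (hq : 0 ≤ (ρ + lam) * ((1 - μ) * ul) - lam * ((ξ μ p - σb μ p) * uh))
    (ha : 0 ≤ (ρ + lam) * (μ * ul) - lam * ((ξ μ p - σg μ p) * uh))
    (m : Menu) (hv : m.Valid) (hic : IC μ p ul uh m) (hir : IR μ ul uh m) :
    revenue ρ m ≤ (1 - ρ) * ((1 - μ) * uh) + (ρ + lam) * ((1 - μ) * ul)
      - lam * ((2 * ξ μ p - μ) * uh) := by
  obtain ⟨⟨_, hgl⟩, ⟨_, hbl⟩, ⟨_, hgh⟩, ⟨_, hbh⟩⟩ := hv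
  have hW : (ξ μ p * m.pgl + σb μ p * (1 - m.pbl)
      + (σg μ p * (1 - m.pgl) + ξ μ p * m.pbl) - μ) * uh ≤ Wh μ p uh m :=
    mul_le_mul_of_nonneg_right (cross_ge μ p m.pgl m.pbl) huh
  have hV : Vh μ uh m ≤ (1 - μ) * uh :=
    mul_le_mul_of_nonneg_right (by nlinarith) huh
  have h1 := mul_le_mul_of_nonneg_left hic.2 hlam0
  have h2 := mul_le_mul_of_nonneg_left hir.1 (add_nonneg hρ0 hlam0)
  have h3 := mul_le_mul_of_nonneg_left hir.2 (sub_nonneg.2 hlam1)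
  have h4 := mul_le_mul_of_nonneg_left hW hlam0
  have h5 := mul_le_mul_of_nonneg_left hV (sub_nonneg.2 hρ1)
  have h6 := mul_nonneg hq (sub_nonneg.2 hbl)
  have h7 := mul_nonneg ha (sub_nonneg.2 hgl)
  unfold revenue
  unfold Vl at h2
  linarith

end TwoTypeScreening

open TwoTypeScreening in
/-- Optimal menu in the region `ξ > σ_g ≥ σ_b` (i.e. `1/2 < p ≤ (1-μ)/μ`,
requiring `μ < 2/3`) when condition (C1) fails. Case (1): rents to the high type with
no distortion; case (2): full surplus extraction with a distorted low-type bad-state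
signal. -/
theorem optimal_menu_high_corr
    (μ p ul uh ρ : ℝ)
    (hμ : μ ∈ Set.Ico (1/2 : ℝ) 1)
    (hp0 : 1/2 < p) (hp1 : p ≤ (1 - μ) / μ)
    (hul : 0 < ul) (hu : ul < uh)
    (hρ : ρ ∈ Set.Ioo (0:ℝ) 1)
    (hnotC1 : (1 - μ) * ul < (ξ μ p - σg μ p) * uh) :
    ((ξ μ p + σb μ p) * ul ≥ (1 - ρ) * (ξ μ p - σb μ p) * uh →
      (let m : Menu := ⟨1, 1, 1, 1, (σb μ p + ξ μ p) * ul,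
          (σg μ p + σb μ p) * uh + (σb μ p + ξ μ p) * ul⟩
       m.Valid ∧ IC μ p ul uh m ∧ IR μ ul uh m ∧ Rsp μ m ∧
       (∀ m' : Menu, m'.Valid → IC μ p ul uh m' → IR μ ul uh m' → Rsp μ m' →
          revenue ρ m' ≤ revenue ρ m) ∧
       m.th < (1 - μ) * uh)) ∧
    (¬ ((ξ μ p + σb μ p) * ul ≥ (1 - ρ) * (ξ μ p - σb μ p) * uh) →
      (let pbl : ℝ := (σg μ p - σb μ p) * uh /
          ((ξ μ p - σb μ p) * uh - (σb μ p + ξ μ p) * ul)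
       let m : Menu := ⟨1, pbl, 1, 1,
          (σb μ p + ξ μ p) * pbl * ul, (σb μ p + ξ μ p) * uh⟩
       m.Valid ∧ IC μ p ul uh m ∧ IR μ ul uh m ∧ Rsp μ m ∧
       (∀ m' : Menu, m'.Valid → IC μ p ul uh m' → IR μ ul uh m' → Rsp μ m' →
          revenue ρ m' ≤ revenue ρ m) ∧
       m.th = (1 - μ) * uh)) := by
  obtain ⟨hμ0, hμ1⟩ := hμ
  obtain ⟨hρ0, hρ1⟩ := hρ
  have hμpos : 0 < μ := by linarith
  have huh : 0 < uh := hul.trans hu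
  rw [le_div_iff₀ hμpos] at hp1
  have hb : 0 ≤ σb μ p := by unfold σb; linarith
  have hgb : σb μ p ≤ σg μ p := by unfold σb σg; linarith
  have hxg : σg μ p < ξ μ p := by unfold σg ξ; nlinarith
  have hμe : μ = σg μ p + ξ μ p := by unfold σg ξ; ring
  have hμe' : 1 - μ = σb μ p + ξ μ p := by unfold σb ξ; ring
  have hbound := revenue_le μ p ul uh ρ
  have hc := cross_one μ p
  generalize σb μ p = b at *
  generalize σg μ p = g at *
  generalize ξ μ p = x at *
  have hgap : 0 ≤ (g - b) * uh := mul_nonneg (sub_nonneg.2 hgb) huh.le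
  have hgap' : 0 ≤ (g - b) * ul := mul_nonneg (sub_nonneg.2 hgb) hul.le
  have hbul : 0 ≤ b * ul := mul_nonneg hb hul.le
  have hbuh : 0 ≤ b * uh := mul_nonneg hb huh.le
  have hxul : 0 < (x - g) * ul := mul_pos (sub_pos.2 hxg) hul
  have hxuh : 0 < (x - g) * uh := mul_pos (sub_pos.2 hxg) huh
  have hc1 : cross μ p 1 1 = x - g := by
    rw [hc 1 zero_le_one (by linarith) (by linarith)]; linarith
  rw [hμe'] at hnotC1
  constructor
  · intro hcase
    refine ⟨by simp [Menu.Valid], ⟨?_, ?_⟩, ⟨?_, ?_⟩, ⟨?_, ?_⟩, fun m' hv hic hir _ => ?_, ?_⟩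
    · simp only [Vl, Wl, hc1, hμe', mul_one]; linarith
    · simp only [Vh, Wh, hc1, hμe', mul_one]; linarith
    · simp only [Vl, hμe', mul_one]; linarith
    · simp only [Vh, hμe', mul_one]; linarith
    · simp only [mul_one]; linarith
    · simp only [mul_one]; linarith
    · have hgap2 := mul_nonneg (sub_nonneg.2 hρ1.le) hgap
      have := hbound (1 - ρ) hμpos.le hμ1.le huh.le hρ0.le hρ1.le (by linarith) le_rfl
        (by rw [hμe']; linarith) (by rw [hμe]; linarith) m' hv hic hir
      rw [hμe', hμe] at this
      simp only [revenue] at this ⊢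
      linarith
    · simp only [hμe']; linarith
  · intro hcase
    push Not at hcase
    have hD : 0 < (x - b) * uh - (b + x) * ul := by linarith
    set D := (x - b) * uh - (b + x) * ul with hDdef
    intro q
    have hqD : q * D = (g - b) * uh := div_mul_cancel₀ _ hD.ne'
    have hq0 : 0 ≤ q := div_nonneg hgap hD.le
    have hq1 : q ≤ 1 := (div_le_one hD).2 (by linarith)
    have hthr : g - b ≤ (x - b) * q := by
      refine le_of_mul_le_mul_right ?_ huh
      nlinarith [mul_nonneg hq0 (mul_nonneg (by linarith : 0 ≤ b + x) hul.le)]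
    have hcq := hc q hq0 (by linarith) hthr
    have hqV : 0 ≤ (1 - μ) * q := mul_nonneg (by linarith) hq0
    refine ⟨⟨by simp, ⟨hq0, hq1⟩, by simp, by simp⟩, ⟨?_, ?_⟩, ⟨?_, ?_⟩, ⟨?_, ?_⟩,
      fun m' hv hic hir _ => ?_, ?_⟩
    · simp only [Vl, Wl, hc1, hμe', mul_one]; linarith
    · simp only [Vh, Wh, hcq, hμe', mul_one]
      have e : (x + b * (1 - q) + x * q - μ) * uh = (x - b) * q * uh - (g - b) * uh := by
        rw [hμe]; ring
      rw [e, ← hqD, hDdef]; linarith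
    · simp only [Vl, hμe', mul_one]; linarith
    · simp only [Vh, hμe', mul_one]; linarith
    · simp only [mul_one]; linarith
    · simp only [mul_one]; linarith
    · set lam := ρ * ((b + x) * ul) / D with hlam
      have hlD : lam * D = ρ * ((b + x) * ul) := div_mul_cancel₀ _ hD.ne'
      have hl0 : 0 ≤ lam := by
        have : 0 ≤ b + x := by linarith
        positivity
      have hl1 : lam ≤ 1 - ρ := by
        rw [hlam, div_le_iff₀ hD, hDdef]; linarith
      have hswap : lam * ((g - b) * uh) = ρ * ((b + x) * ul) * q := by
        rw [← hqD, ← hlD]; ring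
      rw [hDdef] at hlD
      have hg1 := mul_nonneg hl0 hgap
      have hg2 := mul_nonneg (add_nonneg hρ0.le hl0) hgap'
      have := hbound lam hμpos.le hμ1.le huh.le hρ0.le hρ1.le hl0 hl1
        (by rw [hμe']; linarith) (by rw [hμe]; linarith) m' hv hic hir
      rw [hμe', hμe] at this
      simp only [revenue] at this ⊢
      linarith
    · simp only [hμe']
end
end

section
/- Let μ ∈ [1/2,1), λ_b > 0, λ_g = (1-μ)λ_b/μ, and θ̄ > 0. Let u : ℝ → ℝ be differentiable with u(θ) > 0 and u'(θ) ≤ 2λ_b·u(θ) for all θ ∈ [0, θ̄]. Then for all 0 ≤ θ' ≤ θ ≤ θ̄: u(θ') ≥ (1 - 2μ + 2μ·e^{-(θ-θ')(λ_g+λ_b)})·u(θ). -/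
/-- A function satisfying `u' ≤ c u` on `[a, b]` has `exp (-c t) * u t` antitone there. -/
theorem antitoneOn_exp_mul_of_deriv_le {u : ℝ → ℝ} {c a b : ℝ} (hu : Differentiable ℝ u)
    (h : ∀ t ∈ Set.Icc a b, deriv u t ≤ c * u t) :
    AntitoneOn (fun t => Real.exp (-(c * t)) * u t) (Set.Icc a b) := by
  have hd : ∀ t, HasDerivAt (fun t => Real.exp (-(c * t)) * u t)
      (Real.exp (-(c * t)) * (deriv u t - c * u t)) t := fun t => by
    have h1 : HasDerivAt (fun t : ℝ => -(c * t)) (-(c * 1)) t :=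
      ((hasDerivAt_id t).const_mul c).neg
    exact (h1.exp.mul (hu t).hasDerivAt).congr_deriv (by ring)
  refine antitoneOn_of_deriv_nonpos (convex_Icc a b)
    (fun t _ => (hd t).continuousAt.continuousWithinAt)
    (fun t _ => (hd t).differentiableAt.differentiableWithinAt) fun t ht => ?_
  rw [(hd t).deriv]
  exact mul_nonpos_of_nonneg_of_nonpos (Real.exp_pos _).le
    (sub_nonpos.2 (h t (interior_subset ht)))

/-- Bernoulli's inequality in exponential form. -/
theorem one_sub_add_mul_exp_le_exp_mul {p : ℝ} (hp : 1 ≤ p) (y : ℝ) :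
    1 - p + p * Real.exp y ≤ Real.exp (y * p) := by
  have h := one_add_mul_self_le_rpow_one_add
    (show -1 ≤ Real.exp y - 1 by linarith [Real.exp_pos y]) hp
  rw [add_sub_cancel, ← Real.exp_mul] at h
  linarith

/-- sufficiency in Proposition 3: if `u` is differentiable, positive and
satisfies condition (C2) `u' ≤ 2λ_b·u` on `[0, θ̄]`, then every downward incentive
constraint of the fully revealing menu priced at full willingness to pay holds:
`u(θ') ≥ (1 - 2μ + 2μ·e^{-(θ-θ')(λ_g+λ_b)})·u(θ)` for all `0 ≤ θ' ≤ θ ≤ θ̄`. -/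
theorem full_surplus_extraction_sufficiency
    (μ lb θbar : ℝ) (hμ : μ ∈ Set.Ico (1/2 : ℝ) 1) (hlb : 0 < lb)
    (lg : ℝ) (hlg : lg = (1 - μ) * lb / μ) (hθbar : 0 < θbar)
    (u : ℝ → ℝ) (hdiff : Differentiable ℝ u)
    (hpos : ∀ θ ∈ Set.Icc 0 θbar, 0 < u θ)
    (hC2 : ∀ θ ∈ Set.Icc 0 θbar, deriv u θ ≤ 2 * lb * u θ) :
    ∀ θ' θ : ℝ, 0 ≤ θ' → θ' ≤ θ → θ ≤ θbar →
      u θ' ≥ (1 - 2 * μ + 2 * μ * Real.exp (-(θ - θ') * (lg + lb))) * u θ := by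
  intro θ' θ h0 hle hθ
  have hμ0 : 0 < μ := by linarith [hμ.1]
  have hmem : θ ∈ Set.Icc 0 θbar := ⟨h0.trans hle, hθ⟩
  have hanti := antitoneOn_exp_mul_of_deriv_le hdiff hC2 ⟨h0, hle.trans hθ⟩ hmem hle
  have hbern := one_sub_add_mul_exp_le_exp_mul (show 1 ≤ 2 * μ by linarith [hμ.1])
    (-(θ - θ') * (lg + lb))
  have hexp : -(θ - θ') * (lg + lb) * (2 * μ) = 2 * lb * θ' + -(2 * lb * θ) := by
    rw [hlg]
    field_simp
    ring
  rw [hexp, Real.exp_add] at hbern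
  calc (1 - 2 * μ + 2 * μ * Real.exp (-(θ - θ') * (lg + lb))) * u θ
      ≤ Real.exp (2 * lb * θ') * Real.exp (-(2 * lb * θ)) * u θ :=
        mul_le_mul_of_nonneg_right hbern (hpos θ hmem).le
    _ = Real.exp (2 * lb * θ') * (Real.exp (-(2 * lb * θ)) * u θ) := mul_assoc _ _ _
    _ ≤ Real.exp (2 * lb * θ') * (Real.exp (-(2 * lb * θ')) * u θ') :=
        mul_le_mul_of_nonneg_left hanti (Real.exp_pos _).le
    _ = u θ' := by rw [← mul_assoc, ← Real.exp_add, add_neg_cancel, Real.exp_zero, one_mul]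
end

section
/- Let μ ∈ [1/2,1), λ_b > 0, λ_g = (1-μ)λ_b/μ, and θ̄ > 0. Let u : ℝ → ℝ be differentiable with u(θ) > 0 for all θ ∈ [0, θ̄]. If for all 0 ≤ θ' ≤ θ ≤ θ̄ the inequality u(θ') ≥ (1 - 2μ + 2μ·e^{-(θ-θ')(λ_g+λ_b)})·u(θ) holds, then u'(θ) ≤ 2λ_b·u(θ) for every θ ∈ [0, θ̄]. -/
/-- First-order condition at a minimum over a convex set of reals. -/
theorem IsMinOn.mul_hasDerivAt_nonneg {f : ℝ → ℝ} {f' a y : ℝ} {s : Set ℝ}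
    (h : IsMinOn f s a) (hs : Convex ℝ s) (hf : HasDerivAt f f' a) (ha : a ∈ s) (hy : y ∈ s) :
    0 ≤ (y - a) * f' := by
  simpa using h.localize.hasFDerivWithinAt_nonneg hf.hasFDerivAt.hasFDerivWithinAt
    (sub_mem_posTangentConeAt_of_segment_subset (hs.segment_subset ha hy))

/-- necessity in Proposition 3: if the fully revealing menu priced at
full willingness to pay deters all downward imitations, i.e.
`u(θ') ≥ (1 - 2μ + 2μ·e^{-(θ-θ')(λ_g+λ_b)})·u(θ)` for all `0 ≤ θ' ≤ θ ≤ θ̄`, then the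
payoff function satisfies condition (C2): `u' ≤ 2λ_b·u` on `[0, θ̄]`. -/
theorem full_surplus_extraction_necessity
    (μ lb θbar : ℝ) (hμ : μ ∈ Set.Ico (1/2 : ℝ) 1) (hlb : 0 < lb)
    (lg : ℝ) (hlg : lg = (1 - μ) * lb / μ) (hθbar : 0 < θbar)
    (u : ℝ → ℝ) (hdiff : Differentiable ℝ u)
    (hpos : ∀ θ ∈ Set.Icc 0 θbar, 0 < u θ)
    (hIC : ∀ θ' θ : ℝ, 0 ≤ θ' → θ' ≤ θ → θ ≤ θbar →
      u θ' ≥ (1 - 2 * μ + 2 * μ * Real.exp (-(θ - θ') * (lg + lb))) * u θ) :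
    ∀ θ ∈ Set.Icc (0:ℝ) θbar, deriv u θ ≤ 2 * lb * u θ := by
  intro θ hθ
  have hrate : 2 * μ * (lg + lb) = 2 * lb := by
    have : μ ≠ 0 := by linarith [hμ.1]
    rw [hlg]
    field_simp
    ring
  have hu := (hdiff θ).hasDerivAt
  rcases hθ.1.eq_or_lt with rfl | h0
  · have hK : HasDerivAt (fun t : ℝ => 1 - 2 * μ + 2 * μ * Real.exp (-(t - 0) * (lg + lb)))
        (-(2 * lb)) 0 := by
      have := (((((hasDerivAt_id (0 : ℝ)).sub_const 0).neg.mul_const (lg + lb)).exp.const_mul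
        (2 * μ)).const_add (1 - 2 * μ))
      refine this.congr_deriv ?_
      simp
      linarith
    have hmin : IsMinOn (fun t : ℝ => u 0 -
        (1 - 2 * μ + 2 * μ * Real.exp (-(t - 0) * (lg + lb))) * u t) (Set.Icc 0 θbar) 0 := by
      intro t ht
      have := hIC 0 t le_rfl ht.1 ht.2
      simp at this ⊢
      linarith
    have := hmin.mul_hasDerivAt_nonneg (convex_Icc _ _) ((hK.mul hu).const_sub (u 0)) hθ
      (Set.right_mem_Icc.2 hθbar.le)
    have := nonneg_of_mul_nonneg_right this (by simpa using hθbar)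
    simp at this
    linarith
  · have hK : HasDerivAt (fun t : ℝ => 1 - 2 * μ + 2 * μ * Real.exp (-(θ - t) * (lg + lb)))
        (2 * lb) θ := by
      have := (((((hasDerivAt_id θ).const_sub θ).neg.mul_const (lg + lb)).exp.const_mul
        (2 * μ)).const_add (1 - 2 * μ))
      refine this.congr_deriv ?_
      simp
      linarith
    have hmin : IsMinOn (fun t : ℝ => u t -
        (1 - 2 * μ + 2 * μ * Real.exp (-(θ - t) * (lg + lb))) * u θ) (Set.Icc 0 θ) θ := by
      intro t ht
      have := hIC t θ ht.1 ht.2 hθ.2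
      simp at this ⊢
      linarith
    have := hmin.mul_hasDerivAt_nonneg (convex_Icc _ _) (hu.sub (hK.mul_const (u θ)))
      (Set.right_mem_Icc.2 h0.le) (Set.left_mem_Icc.2 h0.le)
    nlinarith
end

section
/- Let μ ∈ (1/2, 1), λ_b > 0, λ_g = (1-μ)λ_b/μ, and let I ⊆ ℝ be an interval. Let u : I → ℝ be positive and differentiable with u'(θ)/u(θ) nonincreasing on I (log-concavity) and u'(θ) > 2λ_b·u(θ) for all θ ∈ I. Define π_g(θ) := ((2μ-1)/μ)·u'(θ)/(u'(θ) - 2λ_g·u(θ)). Then for every θ ∈ I: (i) u'(θ) - 2λ_g·u(θ) > 0; (ii) (μ·π_g(θ) + 1 - 2μ)·u'(θ) - 2μλ_g·π_g(θ)·u(θ) = 0; (iii) (2μ-1)/μ ≤ π_g(θ) < 1; and (iv) π_g is nondecreasing on I. -/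
noncomputable section

/-- The distorted good-state signal precision offered to low types in the optimal menu
of Theorem 2: `π_g(θ) = ((2μ-1)/μ)·u'(θ)/(u'(θ) - 2λ_g·u(θ))`. -/
def distortedPrecision (μ lg : ℝ) (u u' : ℝ → ℝ) (θ : ℝ) : ℝ :=
  ((2 * μ - 1) / μ) * (u' θ / (u' θ - 2 * lg * u θ))

/-- on an interval where `u > 0` is log-concave (`u'/u` nonincreasing)
and `u' > 2λ_b·u`, with `μ ∈ (1/2,1)`, `λ_g = (1-μ)λ_b/μ`, the distorted precision
`π_g` is well defined (`u' - 2λ_g·u > 0`), zeroes the information-rent selection,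
is responsive and strictly below full revelation, and is nondecreasing in the type. -/
theorem distorted_precision_properties
    (μ lb : ℝ) (hμ : μ ∈ Set.Ioo (1/2 : ℝ) 1) (hlb : 0 < lb)
    (lg : ℝ) (hlg : lg = (1 - μ) * lb / μ)
    (I : Set ℝ) (hI : I.OrdConnected)
    (u u' : ℝ → ℝ)
    (hpos : ∀ θ ∈ I, 0 < u θ)
    (hderiv : ∀ θ ∈ I, HasDerivAt u (u' θ) θ)
    (hlogconcave : AntitoneOn (fun θ => u' θ / u θ) I)
    (hnotC2 : ∀ θ ∈ I, u' θ > 2 * lb * u θ) :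
    (∀ θ ∈ I, 0 < u' θ - 2 * lg * u θ) ∧
    (∀ θ ∈ I,
      (μ * distortedPrecision μ lg u u' θ + 1 - 2 * μ) * u' θ -
        2 * μ * lg * distortedPrecision μ lg u u' θ * u θ = 0) ∧
    (∀ θ ∈ I,
      (2 * μ - 1) / μ ≤ distortedPrecision μ lg u u' θ ∧
        distortedPrecision μ lg u u' θ < 1) ∧
    MonotoneOn (distortedPrecision μ lg u u') I := by
  obtain ⟨hμ₀, hμ₁⟩ := hμ
  have hμpos : 0 < μ := by linarith
  have hlgμ : μ * lg = (1 - μ) * lb := by rw [hlg]; field_simp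
  have hlgpos : 0 < lg := by
    rw [hlg]
    exact div_pos (mul_pos (by linarith) hlb) hμpos
  have hlt : lg < lb := by nlinarith
  have hc : 0 < (2 * μ - 1) / μ := div_pos (by linarith) hμpos
  have hden : ∀ θ ∈ I, 0 < u' θ - 2 * lg * u θ := fun θ hθ => by
    have := mul_pos (sub_pos.2 hlt) (hpos θ hθ)
    linarith [hnotC2 θ hθ]
  refine ⟨hden, fun θ hθ => ?_, fun θ hθ => ⟨?_, ?_⟩, fun x hx y hy hxy => ?_⟩
  · have hne := (hden θ hθ).ne'
    unfold distortedPrecision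
    field_simp
    ring
  · have hone : 1 ≤ u' θ / (u' θ - 2 * lg * u θ) := by
      rw [one_le_div (hden θ hθ)]
      linarith [mul_pos hlgpos (hpos θ hθ)]
    exact le_mul_of_one_le_right hc.le hone
  · unfold distortedPrecision
    rw [div_mul_div_comm, div_lt_one (mul_pos hμpos (hden θ hθ))]
    have hgap := mul_pos (sub_pos.2 hμ₁) (sub_pos.2 (hnotC2 θ hθ))
    linear_combination hgap + 2 * u θ * hlgμ
  · unfold distortedPrecision
    refine mul_le_mul_of_nonneg_left ?_ hc.le
    rw [div_le_div_iff₀ (hden x hx) (hden y hy)]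
    have hratio : u' y * u x ≤ u' x * u y :=
      (div_le_div_iff₀ (hpos y hy) (hpos x hx)).1 (hlogconcave hx hy hxy)
    linear_combination 2 * lg * hratio
end
end
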